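/- Let Λ = A_{n,n} be the self-injective Nakayama algebra with n > 1 simple modules and Loewy length n (i.e. m = n). Then every non-projective indecomposable Λ-module X satisfies Ext¹_Λ(X,X) = 0 and Ext²_Λ(X,X) ≠ 0; that is, rd(X) = 1. -/

import Mathlib

open CategoryTheory CategoryTheory.Limits Opposite

universe u

namespace Rigidity

variable (Λ : Type u) [Ring Λ]

/-- `X` belongs to `add M`: it is a direct summand of a finite direct sum of copies of `M`. -/
def InAdd (M X : ModuleCat.{u} Λ) : Prop :=
  ∃ (r : ℕ) (Y : ModuleCat.{u} Λ), Nonempty ((X ⊞ Y) ≅ ⨁ (fun _ : Fin r => M))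

/-- An indecomposable object. -/
def Indec (X : ModuleCat.{u} Λ) : Prop :=
  ¬ IsZero X ∧ ∀ A B : ModuleCat.{u} Λ, Nonempty (X ≅ A ⊞ B) → IsZero A ∨ IsZero B

/-- A generator-cogenerator: `add M` contains the regular module and all
finitely generated injective modules. -/
def IsGenCogen (M : ModuleCat.{u} Λ) : Prop :=
  InAdd Λ M (ModuleCat.of Λ Λ) ∧
  ∀ I : ModuleCat.{u} Λ, Module.Finite Λ I → Injective I → InAdd Λ M I

/-- `g : A ⟶ X` is a right minimal `add M`-approximation. -/
def IsRMApprox (M : ModuleCat.{u} Λ) {A X : ModuleCat.{u} Λ} (g : A ⟶ X) : Prop :=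
  InAdd Λ M A ∧
  (∀ T : ModuleCat.{u} Λ, InAdd Λ M T → ∀ f : T ⟶ X, ∃ h : T ⟶ A, h ≫ g = f) ∧
  (∀ h : A ⟶ A, h ≫ g = g → IsIso h)

/-- `IsMSyzygy M X r W` : `W` is an `r`-th `M`-syzygy `Ω_M^r(X)` of `X`. -/
inductive IsMSyzygy (M : ModuleCat.{u} Λ) : ModuleCat.{u} Λ → ℕ → ModuleCat.{u} Λ → Prop
  | zero (X : ModuleCat.{u} Λ) : IsMSyzygy M X 0 X
  | succ (X : ModuleCat.{u} Λ) (r : ℕ) (W A : ModuleCat.{u} Λ) (g : A ⟶ W)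
      (hW : IsMSyzygy M X r W) (hg : IsRMApprox Λ M g) :
      IsMSyzygy M X (r + 1) (kernel g)

/-- The `M`-dimension of `X` is at most `r`. -/
def MdimLE (M X : ModuleCat.{u} Λ) (r : ℕ) : Prop :=
  ∃ W : ModuleCat.{u} Λ, IsMSyzygy Λ M X r W ∧ InAdd Λ M W

/-- projective dimension at most `r`, via a length `r` projective resolution. -/
def ProjDimLE (A : Type u) [Ring A] (N : ModuleCat.{u} A) (r : ℕ) : Prop :=
  ∃ (P : ℕ → ModuleCat.{u} A) (d : ∀ i : ℕ, P (i + 1) ⟶ P i) (f : P 0 ⟶ N),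
    (∀ i, Projective (P i)) ∧ (∀ i, r < i → IsZero (P i)) ∧ Epi f ∧
    (∃ w : d 0 ≫ f = 0, (ShortComplex.mk (d 0) f w).Exact) ∧
    (∀ i, ∃ w : d (i + 1) ≫ d i = 0, (ShortComplex.mk (d (i + 1)) (d i) w).Exact)

/-- global dimension at most `r`. -/
def GldimLE (A : Type u) [Ring A] (r : ℕ) : Prop :=
  ∀ N : ModuleCat.{u} A, ProjDimLE A N r

/-- the global dimension, as an element of `ℕ∞`. -/
noncomputable def gldim (A : Type u) [Ring A] : ℕ∞ :=
  sInf {c : ℕ∞ | ∃ r : ℕ, c = (r : ℕ∞) ∧ GldimLE A r}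

/-- dominant dimension at least `r`: there is an exact sequence
`0 → A → I^0 → ⋯ → I^(r-1)` with all `I^i` projective-injective. -/
def DomdimGE (A : Type u) [Ring A] (r : ℕ) : Prop :=
  ∃ (I : ℕ → ModuleCat.{u} A) (f : ModuleCat.of A A ⟶ I 0) (g : ∀ i : ℕ, I i ⟶ I (i + 1)),
    Mono f ∧ (∀ i, i < r → Injective (I i) ∧ Projective (I i)) ∧
    (2 ≤ r → ∃ w : f ≫ g 0 = 0, (ShortComplex.mk f (g 0) w).Exact) ∧
    (∀ i, i + 3 ≤ r → ∃ w : g i ≫ g (i + 1) = 0, (ShortComplex.mk (g i) (g (i + 1)) w).Exact)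

/-- the dominant dimension, as an element of `ℕ∞`. -/
noncomputable def domdim (A : Type u) [Ring A] : ℕ∞ :=
  sSup {c : ℕ∞ | ∃ r : ℕ, c = (r : ℕ∞) ∧ DomdimGE A r}

/-- the rigidity degree of a module, as an element of `ℕ∞`. -/
noncomputable def rigDeg [HasExt.{u} (ModuleCat.{u} Λ)] (M : ModuleCat.{u} Λ) : ℕ∞ :=
  sSup {c : ℕ∞ | ∃ r : ℕ, c = (r : ℕ∞) ∧ 0 < r ∧
    ∀ i : ℕ, 1 ≤ i → i ≤ r → Subsingleton (Abelian.Ext M M i)}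

/-- the rigidity dimension. -/
noncomputable def rigdim : ℕ∞ :=
  sSup {c : ℕ∞ | ∃ M : ModuleCat.{u} Λ, Module.Finite Λ M ∧ IsGenCogen Λ M ∧
    (∃ r : ℕ, GldimLE (End (op M)) r) ∧ c = domdim (End (op M))}

/-- An Auslander-Reiten (almost split) sequence. -/
def IsARSeq {X Y Z : ModuleCat.{u} Λ} (f : X ⟶ Y) (g : Y ⟶ Z) : Prop :=
  Mono f ∧ Epi g ∧ (∃ w : f ≫ g = 0, (ShortComplex.mk f g w).Exact) ∧
  Indec Λ X ∧ Indec Λ Z ∧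
  (¬ ∃ s : Z ⟶ Y, s ≫ g = 𝟙 Z) ∧
  (∀ (W : ModuleCat.{u} Λ) (h : W ⟶ Z), (¬ ∃ s : Z ⟶ W, s ≫ h = 𝟙 Z) →
    ∃ h' : W ⟶ Y, h' ≫ g = h)

/-- `X` has composition length `t`. -/
def HasCompLength (X : ModuleCat.{u} Λ) (t : ℕ) : Prop :=
  (∃ c : Fin (t + 1) → Submodule Λ X, StrictMono c ∧ c 0 = ⊥ ∧ c (Fin.last t) = ⊤) ∧
  ∀ r : ℕ, (∃ c : Fin (r + 1) → Submodule Λ X, StrictMono c ∧ c 0 = ⊥ ∧ c (Fin.last r) = ⊤) →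
    r ≤ t


/-- powers of the Jacobson radical, as left submodules of `Λ`. -/
def radPow (Λ : Type u) [Ring Λ] : ℕ → Submodule Λ Λ
  | 0 => ⊤
  | r + 1 => Submodule.span Λ
      {x : Λ | ∃ a ∈ Ideal.jacobson (⊥ : Ideal Λ), ∃ b ∈ radPow Λ r, x = a * b}

/-- `Λ` is the connected self-injective Nakayama algebra over `k`
with `n` simple modules and Loewy length `m`. -/
structure IsSelfInjNakayama (k : Type u) (Λ : Type u) [Field k] [Ring Λ] [Algebra k Λ]
    (n m : ℕ) : Prop where
  findim : FiniteDimensional k Λ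
  connected : ∀ e : Λ, IsIdempotentElem e → e ∈ Set.center Λ → e = 0 ∨ e = 1
  selfinj : Injective (ModuleCat.of Λ Λ)
  uniserial : ∀ X : ModuleCat.{u} Λ, Module.Finite Λ X → Indec Λ X →
    ∀ N₁ N₂ : Submodule Λ X, N₁ ≤ N₂ ∨ N₂ ≤ N₁
  simples : ∃ S : Fin n → ModuleCat.{u} Λ, (∀ i, IsSimpleModule Λ (S i)) ∧
    (∀ i j, Nonempty (S i ≅ S j) → i = j) ∧
    ∀ T : ModuleCat.{u} Λ, IsSimpleModule Λ T → ∃ i, Nonempty (T ≅ S i)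
  loewy_top : radPow Λ m = ⊥
  loewy_bot : radPow Λ (m - 1) ≠ ⊥

section Nakayama

open LinearMap

variable {Λ}

section Ext

/-- The short exact sequence `0 → ker p → P → X → 0` of a surjection `p`. -/
def kerSeq {P X : Type u} [AddCommGroup P] [Module Λ P] [AddCommGroup X] [Module Λ X]
    (p : P →ₗ[Λ] X) : ShortComplex (ModuleCat.{u} Λ) :=
  ShortComplex.mk (ModuleCat.ofHom (ker p).subtype) (ModuleCat.ofHom p) (by
    ext x; exact x.2)

theorem kerSeq_shortExact {P X : Type u} [AddCommGroup P] [Module Λ P] [AddCommGroup X]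
    [Module Λ X] (p : P →ₗ[Λ] X) (hp : Function.Surjective p) : (kerSeq p).ShortExact where
  exact := by
    rw [ShortComplex.moduleCat_exact_iff]
    intro x hx
    exact ⟨⟨x, hx⟩, rfl⟩
  mono_f := (ModuleCat.mono_iff_injective _).2 (ker p).injective_subtype
  epi_g := (ModuleCat.epi_iff_surjective _).2 hp

variable [HasExt.{u} (ModuleCat.{u} Λ)]

theorem subsingleton_ext_one {P X Y : Type u} [AddCommGroup P] [Module Λ P] [AddCommGroup X]
    [Module Λ X] [AddCommGroup Y] [Module Λ Y] [Module.Projective Λ P]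
    (p : P →ₗ[Λ] X) (hp : Function.Surjective p) (h : ∀ g : ker p →ₗ[Λ] Y, g = 0) :
    Subsingleton (Abelian.Ext (ModuleCat.of Λ X) (ModuleCat.of Λ Y) 1) := by
  refine subsingleton_of_forall_eq 0 fun x => ?_
  have hS := kerSeq_shortExact p hp
  have : Projective (kerSeq p).X₂ :=
    ModuleCat.projective_of_categoryTheory_projective (ModuleCat.of Λ P)
  obtain ⟨y, rfl⟩ := Abelian.Ext.contravariant_sequence_exact₃ hS (ModuleCat.of Λ Y) x
    (Abelian.Ext.eq_zero_of_projective _) (n₀ := 0) rfl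
  obtain ⟨f, rfl⟩ := (Abelian.Ext.mk₀_bijective _ _).2 y
  have hf : f = 0 := by
    ext z
    exact LinearMap.congr_fun (h f.hom) z
  rw [hf, Abelian.Ext.mk₀_zero, Abelian.Ext.comp_zero]
  rfl

theorem exists_extension_of_subsingleton_ext {P X Y : Type u} [AddCommGroup P] [Module Λ P]
    [AddCommGroup X] [Module Λ X] [AddCommGroup Y] [Module Λ Y]
    (p : P →ₗ[Λ] X) (hp : Function.Surjective p)
    (h : Subsingleton (Abelian.Ext (ModuleCat.of Λ X) (ModuleCat.of Λ Y) 1))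
    (g : ker p →ₗ[Λ] Y) : ∃ g' : P →ₗ[Λ] Y, g' ∘ₗ (ker p).subtype = g := by
  have hS := kerSeq_shortExact p hp
  obtain ⟨y, hy⟩ := Abelian.Ext.contravariant_sequence_exact₁ hS (ModuleCat.of Λ Y)
    (Abelian.Ext.mk₀ (ModuleCat.ofHom g)) (n₁ := 1) rfl (h.elim _ _)
  obtain ⟨f, rfl⟩ := (Abelian.Ext.mk₀_bijective _ _).2 y
  rw [Abelian.Ext.mk₀_comp_mk₀] at hy
  have := (Abelian.Ext.mk₀_bijective _ _).1 hy
  exact ⟨f.hom, congrArg ModuleCat.Hom.hom this⟩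

theorem subsingleton_ext_one_ker {P X Y : Type u} [AddCommGroup P] [Module Λ P]
    [AddCommGroup X] [Module Λ X] [AddCommGroup Y] [Module Λ Y] [Module.Projective Λ P]
    (p : P →ₗ[Λ] X) (hp : Function.Surjective p)
    (h : Subsingleton (Abelian.Ext (ModuleCat.of Λ X) (ModuleCat.of Λ Y) 2)) :
    Subsingleton (Abelian.Ext (ModuleCat.of Λ (ker p)) (ModuleCat.of Λ Y) 1) := by
  refine subsingleton_of_forall_eq 0 fun x => ?_
  have hS := kerSeq_shortExact p hp
  have : Projective (kerSeq p).X₂ :=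
    ModuleCat.projective_of_categoryTheory_projective (ModuleCat.of Λ P)
  obtain ⟨y, rfl⟩ := Abelian.Ext.contravariant_sequence_exact₁ hS (ModuleCat.of Λ Y)
    x (n₁ := 2) rfl (h.elim _ _)
  rw [Abelian.Ext.eq_zero_of_projective y, Abelian.Ext.comp_zero]
  rfl

theorem not_subsingleton_ext_two {P Q X : Type u} [AddCommGroup P] [Module Λ P]
    [AddCommGroup Q] [Module Λ Q] [AddCommGroup X] [Module Λ X]
    [Module.Projective Λ P] [Module.Projective Λ Q]
    (p : P →ₗ[Λ] X) (hp : Function.Surjective p) (q : Q →ₗ[Λ] ker p)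
    (hq : Function.Surjective q) (e : ker q ≃ₗ[Λ] X) (hX : ¬ Module.Projective Λ X) :
    ¬ Subsingleton (Abelian.Ext (ModuleCat.of Λ X) (ModuleCat.of Λ X) 2) := by
  intro h
  obtain ⟨r, hr⟩ := exists_extension_of_subsingleton_ext q hq
    (subsingleton_ext_one_ker p hp h) e.toLinearMap
  refine hX (Module.Projective.of_split ((ker q).subtype ∘ₗ e.symm.toLinearMap) r ?_)
  rw [← LinearMap.comp_assoc, hr]
  ext x
  simp

theorem rigDeg_eq_one (X : ModuleCat.{u} Λ) (h₁ : Subsingleton (Abelian.Ext X X 1))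
    (h₂ : ¬ Subsingleton (Abelian.Ext X X 2)) : rigDeg Λ X = 1 := by
  refine IsLUB.sSup_eq (IsGreatest.isLUB ⟨⟨1, rfl, one_pos, fun i h h' => ?_⟩, ?_⟩)
  · obtain rfl := le_antisymm h' h
    exact h₁
  · rintro c ⟨r, rfl, -, hr⟩
    by_contra! hc
    exact h₂ (hr 2 one_le_two (by exact_mod_cast Order.add_one_le_of_lt hc))

end Ext

section Uniserial
variable {M N : Type u} [AddCommGroup M] [Module Λ M] [AddCommGroup N] [Module Λ N]

variable (Λ M) in
/-- A module whose submodules form a chain. -/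
def Uniserial : Prop :=
  ∀ N₁ N₂ : Submodule Λ M, N₁ ≤ N₂ ∨ N₂ ≤ N₁

theorem Uniserial.le_coatom (h : Uniserial Λ M) {A C : Submodule Λ M} (hC : IsCoatom C)
    (hA : A ≠ ⊤) : A ≤ C := by
  rcases h A C with h | h
  · exact h
  · exact ((hC.le_iff.1 h).resolve_left hA).le

theorem Uniserial.coatom_unique (h : Uniserial Λ M) {A C : Submodule Λ M} (hC : IsCoatom C)
    (hA : IsCoatom A) : A = C :=
  le_antisymm (h.le_coatom hC hA.1) (h.le_coatom hA hC.1)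

theorem Uniserial.submodule (h : Uniserial Λ M) (A : Submodule Λ M) : Uniserial Λ A := by
  intro B C
  have := h (B.map A.subtype) (C.map A.subtype)
  rwa [Submodule.map_le_map_iff_of_injective A.injective_subtype,
    Submodule.map_le_map_iff_of_injective A.injective_subtype] at this

/-- In a split epimorphism-monomorphism pair out of a uniserial module, one factor vanishes. -/
theorem Uniserial.eq_bot_of_leftInverse (h : Uniserial Λ M) (s : N →ₗ[Λ] M) (r : M →ₗ[Λ] N)
    (hrs : ∀ x, r (s x) = x) [Nontrivial N] : ker r = ⊥ := by
  rcases h (range s) (ker r) with h | h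
  · obtain ⟨x, hx⟩ := exists_ne (0 : N)
    exact absurd (by rw [← hrs x]; exact h ⟨x, rfl⟩) hx
  · rw [eq_bot_iff]
    intro y hy
    obtain ⟨x, rfl⟩ := h hy
    have : x = 0 := by rw [← hrs x]; exact hy
    simp [this]

theorem length_eq_add_quotient (A : Submodule Λ M) :
    Module.length Λ M = Module.length Λ A + Module.length Λ (M ⧸ A) :=
  Module.length_eq_add_of_exact A.subtype A.mkQ A.injective_subtype A.mkQ_surjective
    (LinearMap.exact_subtype_mkQ A)

theorem length_eq_add_ker (f : M →ₗ[Λ] N) (hf : Function.Surjective f) :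
    Module.length Λ M = Module.length Λ (ker f) + Module.length Λ N :=
  Module.length_eq_add_of_exact (ker f).subtype f (ker f).injective_subtype hf
    (LinearMap.exact_subtype_ker_map f)

theorem length_eq_of_isCoatom {C : Submodule Λ M} (hC : IsCoatom C) :
    Module.length Λ M = Module.length Λ C + 1 := by
  have := isSimpleModule_iff_isCoatom.2 hC
  rw [length_eq_add_quotient C, Module.length_eq_one (R := Λ) (M := M ⧸ C)]

theorem smul_top_le_coatom {C : Submodule Λ M} (hC : IsCoatom C) :
    Ideal.jacobson (⊥ : Ideal Λ) • (⊤ : Submodule Λ M) ≤ C := by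
  rw [Ideal.jacobson_bot]
  exact (Ring.jacobson_smul_top_le Λ M).trans (sInf_le hC)

theorem jacobson_le_smul_top [Module.Projective Λ M] :
    Module.jacobson Λ M ≤ Ideal.jacobson (⊥ : Ideal Λ) • (⊤ : Submodule Λ M) := by
  rw [Ideal.jacobson_bot]
  intro y hy
  obtain ⟨s, hs⟩ := (Module.projective_def (R := Λ) (P := M)).1 inferInstance
  rw [← hs y, Finsupp.linearCombination_apply]
  refine Submodule.sum_mem _ fun x _ => Submodule.smul_mem_smul ?_ trivial
  exact Module.le_comap_jacobson (Finsupp.lapply x ∘ₗ s) hy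

theorem Uniserial.coatom_le_smul_top [Module.Projective Λ M] (h : Uniserial Λ M)
    {C : Submodule Λ M} (hC : IsCoatom C) :
    C ≤ Ideal.jacobson (⊥ : Ideal Λ) • (⊤ : Submodule Λ M) :=
  le_trans (le_sInf fun _ hA => (h.coatom_unique hA hC).le) jacobson_le_smul_top

theorem radPow_succ (t : ℕ) :
    radPow Λ (t + 1) = Ideal.jacobson (⊥ : Ideal Λ) • radPow Λ t := by
  refine le_antisymm (Submodule.span_le.2 ?_) (Submodule.smul_le.2 ?_)
  · rintro _ ⟨a, ha, b, hb, rfl⟩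
    exact Submodule.smul_mem_smul ha hb
  · exact fun a ha b hb => Submodule.subset_span ⟨a, ha, b, hb, rfl⟩

theorem radPow_succ_smul (t : ℕ) (A : Submodule Λ M) :
    radPow Λ (t + 1) • A = radPow Λ t • (Ideal.jacobson (⊥ : Ideal Λ) • A) := by
  induction t with
  | zero =>
    have h : ∀ B : Submodule Λ M, radPow Λ 0 • B = B := fun B => Submodule.top_smul B
    rw [radPow_succ, Submodule.smul_assoc, h, h]
  | succ t ih => rw [radPow_succ, Submodule.smul_assoc, ih, radPow_succ t, Submodule.smul_assoc]

theorem radPow_smul_eq_bot [IsNoetherian Λ M] [IsArtinian Λ M] (t : ℕ)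
    (h : Module.length Λ M ≤ t) : radPow Λ t • (⊤ : Submodule Λ M) = ⊥ := by
  induction t generalizing M with
  | zero =>
    have := Module.length_eq_zero_iff.1 (le_antisymm h zero_le)
    exact Subsingleton.elim _ _
  | succ t ih =>
    rcases eq_top_or_exists_le_coatom (⊥ : Submodule Λ M) with hM | ⟨C, hC, -⟩
    · rw [← hM, Submodule.smul_bot]
    · have hl : Module.length Λ C ≤ t := by
        rw [length_eq_of_isCoatom hC] at h
        push_cast at h
        exact (ENat.add_le_add_iff_right ENat.one_ne_top).1 h
      rw [eq_bot_iff, radPow_succ_smul]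
      refine (smul_mono_right _ (smul_top_le_coatom hC)).trans ?_
      have := congrArg (Submodule.map C.subtype) (ih hl)
      rw [Submodule.map_smul'', Submodule.map_top, Submodule.range_subtype,
        Submodule.map_bot] at this
      exact this.le

theorem Uniserial.eq_of_length_eq [IsNoetherian Λ M] [IsArtinian Λ M] (h : Uniserial Λ M)
    {A C : Submodule Λ M} (hAC : Module.length Λ A = Module.length Λ C) : A = C := by
  rw [Module.length_submodule, Module.length_submodule] at hAC
  rcases h A C with h | h
  · exact h.eq_of_not_lt fun hlt => (Submodule.height_strictMono hlt).ne hAC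
  · exact (h.eq_of_not_lt fun hlt => (Submodule.height_strictMono hlt).ne hAC.symm).symm

end Uniserial

variable (Λ) in
/-- A complete irredundant family of uniserial indecomposable projective modules `P i`,
with unique maximal submodules `R i`. -/
structure PimSystem (ι : Type) where
  P : ι → ModuleCat.{u} Λ
  R : ∀ i, Submodule Λ (P i)
  projective : ∀ i, Module.Projective Λ (P i)
  finite : ∀ i, Module.Finite Λ (P i)
  uniserial : ∀ i, Uniserial Λ (P i)
  isCoatom : ∀ i, IsCoatom (R i)
  eq_of_equiv : ∀ i j, Nonempty ((P i ⧸ R i) ≃ₗ[Λ] (P j ⧸ R j)) → i = j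
  exists_equiv : ∀ (T : Type u) [AddCommGroup T] [Module Λ T], IsSimpleModule Λ T →
    ∃ i, Nonempty (T ≃ₗ[Λ] (P i ⧸ R i))

namespace PimSystem

attribute [instance] PimSystem.projective PimSystem.finite

variable {ι : Type} (D : PimSystem Λ ι) {M N : Type u} [AddCommGroup M] [Module Λ M]
  [AddCommGroup N] [Module Λ N]

instance (i : ι) : Nontrivial (D.P i) :=
  (Submodule.nontrivial_iff Λ).1 ⟨_, _, (D.isCoatom i).1⟩

/-- A proper submodule of a finite module misses the image of some `P i`. -/
theorem exists_not_range_le [Module.Finite Λ M] {A : Submodule Λ M} (hA : A ≠ ⊤) :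
    ∃ (i : ι) (f : D.P i →ₗ[Λ] M), ¬ range f ≤ A := by
  obtain ⟨C, hC, hAC⟩ := (eq_top_or_exists_le_coatom A).resolve_left hA
  obtain ⟨i, ⟨e⟩⟩ := D.exists_equiv _ (isSimpleModule_iff_isCoatom.2 hC)
  obtain ⟨f, hf⟩ := Module.projective_lifting_property C.mkQ
    (e.symm.toLinearMap ∘ₗ (D.R i).mkQ) C.mkQ_surjective
  refine ⟨i, f, fun h => (D.isCoatom i).1 (eq_top_iff.2 fun x _ => ?_)⟩
  have h1 : C.mkQ (f x) = 0 := (Submodule.Quotient.mk_eq_zero _).2 (hAC (h ⟨x, rfl⟩))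
  rw [← LinearMap.comp_apply, hf] at h1
  exact (Submodule.Quotient.mk_eq_zero _).1 (e.symm.map_eq_zero_iff.1 h1)

theorem exists_surjective [Module.Finite Λ M] [Nontrivial M] (hM : Uniserial Λ M) :
    ∃ (i : ι) (f : D.P i →ₗ[Λ] M), Function.Surjective f := by
  obtain ⟨C, hC, -⟩ :=
    (eq_top_or_exists_le_coatom (⊥ : Submodule Λ M)).resolve_left bot_ne_top
  obtain ⟨i, f, hf⟩ := D.exists_not_range_le hC.1
  exact ⟨i, f, range_eq_top.1 (by_contra fun h => hf (hM.le_coatom hC h))⟩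

theorem eq_of_surjective [Module.Finite Λ M] [Nontrivial M] {i j : ι} (f : D.P i →ₗ[Λ] M)
    (g : D.P j →ₗ[Λ] M) (hf : Function.Surjective f) (hg : Function.Surjective g) : i = j := by
  obtain ⟨C, hC, -⟩ :=
    (eq_top_or_exists_le_coatom (⊥ : Submodule Λ M)).resolve_left bot_ne_top
  have key : ∀ (i : ι) (f : D.P i →ₗ[Λ] M), Function.Surjective f →
      Nonempty ((D.P i ⧸ D.R i) ≃ₗ[Λ] (M ⧸ C)) := by
    intro i f hf
    have h : ker (C.mkQ ∘ₗ f) = D.R i := by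
      refine (D.uniserial i).coatom_unique (D.isCoatom i) ?_
      rw [ker_comp, Submodule.ker_mkQ]
      exact (Submodule.isCoatom_comap_iff hf).2 hC
    exact ⟨(Submodule.quotEquivOfEq _ _ h.symm).trans
      (quotKerEquivOfSurjective _ (C.mkQ_surjective.comp hf))⟩
  obtain ⟨e⟩ := key i f hf
  obtain ⟨e'⟩ := key j g hg
  exact D.eq_of_equiv i j ⟨e.trans e'.symm⟩

theorem exists_retract (j : ι) : ∃ (s : D.P j →ₗ[Λ] Λ) (r : Λ →ₗ[Λ] D.P j), ∀ x, r (s x) = x := by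
  obtain ⟨p, hp⟩ : ∃ p, p ∉ D.R j := by
    by_contra! h
    exact (D.isCoatom j).1 (eq_top_iff.2 fun x _ => h x)
  have hr : Function.Surjective (toSpanSingleton Λ (D.P j) p) := by
    refine range_eq_top.1 (by_contra fun h => hp ?_)
    exact (D.uniserial j).le_coatom (D.isCoatom j) h ⟨1, by simp⟩
  obtain ⟨s, hs⟩ := Module.projective_lifting_property _ LinearMap.id hr
  exact ⟨s, toSpanSingleton Λ (D.P j) p, fun x => LinearMap.congr_fun hs x⟩

theorem exists_extension [Module.Injective Λ Λ] {j : ι} (u : M →ₗ[Λ] N)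
    (hu : Function.Injective u) (g : M →ₗ[Λ] D.P j) : ∃ h : N →ₗ[Λ] D.P j, ∀ x, h (u x) = g x := by
  obtain ⟨s, r, hrs⟩ := D.exists_retract j
  obtain ⟨h, hh⟩ := Module.Injective.out u hu (s ∘ₗ g)
  exact ⟨r ∘ₗ h, fun x => by simp [hh, hrs]⟩

theorem surjective_of_injective [Module.Injective Λ Λ] {i j : ι} (h : D.P i →ₗ[Λ] D.P j)
    (hh : Function.Injective h) : Function.Surjective h := by
  obtain ⟨r, hr⟩ := D.exists_extension h hh LinearMap.id
  have := ker_eq_bot.1 ((D.uniserial j).eq_bot_of_leftInverse h r hr)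
  exact fun y => ⟨r y, this (hr _)⟩

theorem range_le_of_ne [Module.Injective Λ Λ] {i j : ι} (hij : i ≠ j) (h : D.P i →ₗ[Λ] D.P j) :
    range h ≤ D.R j := by
  refine (D.uniserial j).le_coatom (D.isCoatom j) fun ht => hij ?_
  exact D.eq_of_surjective h LinearMap.id (range_eq_top.1 ht) Function.surjective_id

theorem mem_of_connected
    (hconn : ∀ e : Λ, IsIdempotentElem e → e ∈ Set.center Λ → e = 0 ∨ e = 1) (O : Set ι)
    (h₁ : ∀ i ∈ O, ∀ j ∉ O, ∀ g : D.P i →ₗ[Λ] D.P j, g = 0)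
    (h₂ : ∀ i ∈ O, ∀ j ∉ O, ∀ g : D.P j →ₗ[Λ] D.P i, g = 0) {a : ι} (ha : a ∈ O) (b : ι) :
    b ∈ O := by
  by_contra hb
  let tr : Set ι → Submodule Λ Λ := fun U => ⨆ x : (i : U) × (D.P i →ₗ[Λ] Λ), range x.2
  have hle : ∀ (U : Set ι) (i : ι) (_ : i ∈ U) (f : D.P i →ₗ[Λ] Λ), range f ≤ tr U :=
    fun U i hi f => le_iSup (fun x : (i : U) × (D.P i →ₗ[Λ] Λ) => range x.2) ⟨⟨i, hi⟩, f⟩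
  have htop : tr O ⊔ tr Oᶜ = ⊤ := by
    by_contra h
    obtain ⟨i, f, hf⟩ := D.exists_not_range_le h
    by_cases hi : i ∈ O
    · exact hf ((hle O i hi f).trans le_sup_left)
    · exact hf ((hle Oᶜ i hi f).trans le_sup_right)
  have hmul : ∀ U V : Set ι, (∀ i ∈ U, ∀ j ∈ V, ∀ g : D.P i →ₗ[Λ] D.P j, g = 0) →
      ∀ x ∈ tr U, ∀ y ∈ tr V, x * y = 0 := by
    intro U V hUV x hx y hy
    induction hy using Submodule.iSup_induction' with
    | zero => simp
    | add y z _ _ hy hz => rw [mul_add, hy, hz, add_zero]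
    | mem j y hy =>
      obtain ⟨q, rfl⟩ := hy
      induction hx using Submodule.iSup_induction' with
      | zero => simp
      | add y z _ _ hy hz => rw [add_mul, hy, hz, add_zero]
      | mem i x hx =>
        obtain ⟨p, rfl⟩ := hx
        have := LinearMap.congr_fun (hUV _ i.1.2 _ j.1.2 ((toSpanSingleton Λ _ q) ∘ₗ i.2)) p
        rw [← smul_eq_mul, ← map_smul]
        simpa using congrArg j.2 this
  have hAB := hmul O Oᶜ h₁
  have hBA := hmul Oᶜ O fun i hi j hj => h₂ j hj i hi
  obtain ⟨e, he, f, hf, hef⟩ :=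
    Submodule.mem_sup.1 (htop ▸ Submodule.mem_top : (1 : Λ) ∈ tr O ⊔ tr Oᶜ)
  have hidem : e * e = e := by
    conv_rhs => rw [← mul_one e, ← hef, mul_add, hAB e he f hf, add_zero]
  have hcenter : e ∈ Set.center Λ := by
    rw [Semigroup.mem_center_iff]
    intro x
    have h3 : e * (x * f) = 0 := hAB e he _ ((tr Oᶜ).smul_mem x hf)
    have h4 : f * (x * e) = 0 := hBA f hf _ ((tr O).smul_mem x he)
    calc x * e = (e + f) * (x * e) := by rw [hef, one_mul]
      _ = e * (x * (e + f)) := by rw [add_mul, h4, mul_add, mul_add, h3]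
      _ = e * x := by rw [hef, mul_one]
  have hzero : ∀ (U : Set ι) (i : ι), i ∈ U → tr U ≠ ⊥ := by
    intro U i hi h
    obtain ⟨s, r, hrs⟩ := D.exists_retract i
    obtain ⟨x, hx⟩ := exists_ne (0 : D.P i)
    have : s x = 0 := by
      rw [← Submodule.mem_bot Λ, ← h]
      exact hle U i hi s ⟨x, rfl⟩
    exact hx (by rw [← hrs x, this, map_zero])
  rcases hconn e hidem hcenter with rfl | rfl
  · refine hzero O a ha (eq_bot_iff.2 fun x hx => ?_)
    rw [zero_add] at hef
    rw [Submodule.mem_bot, ← one_mul x, ← hef, hBA f hf x hx]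
  · refine hzero Oᶜ b hb (eq_bot_iff.2 fun x hx => ?_)
    rw [Submodule.mem_bot, ← one_mul x, hAB 1 he x hx]

theorem R_ne_bot [Module.Injective Λ Λ] [Nontrivial ι]
    (hconn : ∀ e : Λ, IsIdempotentElem e → e ∈ Set.center Λ → e = 0 ∨ e = 1) (i : ι) :
    D.R i ≠ ⊥ := by
  intro hi
  obtain ⟨j, hj⟩ := exists_ne i
  refine hj (D.mem_of_connected hconn {i} ?_ ?_ rfl j)
  · rintro _ rfl j hj g
    by_contra hg
    have hker : ker g = ⊥ := by
      rw [eq_bot_iff, ← hi]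
      exact (D.uniserial _).le_coatom (D.isCoatom _) fun h => hg (ker_eq_top.1 h)
    have := D.surjective_of_injective g (ker_eq_bot.1 hker)
    exact hj (D.eq_of_surjective g LinearMap.id this Function.surjective_id).symm
  · rintro _ rfl j hj g
    have := D.range_le_of_ne hj g
    rw [hi, le_bot_iff] at this
    exact range_eq_bot.1 this

theorem exists_cover_R [IsNoetherianRing Λ] (hR : ∀ i, D.R i ≠ ⊥) (i : ι) :
    ∃ (j : ι) (f : D.P j →ₗ[Λ] D.P i), range f = D.R i := by
  have := Submodule.nontrivial_iff_ne_bot.2 (hR i)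
  obtain ⟨j, f, hf⟩ := D.exists_surjective ((D.uniserial i).submodule (D.R i))
  refine ⟨j, (D.R i).subtype ∘ₗ f, ?_⟩
  rw [range_comp, range_eq_top.2 hf, Submodule.map_top, Submodule.range_subtype]

theorem eq_of_ker_le [Module.Injective Λ Λ] (hR : ∀ i, D.R i ≠ ⊥) {i j k : ι}
    (f : D.P k →ₗ[Λ] D.P i) (g : D.P k →ₗ[Λ] D.P j) (hf : range f = D.R i)
    (hg : range g = D.R j) (h : ker f ≤ ker g) : i = j := by
  by_contra hij
  obtain ⟨φ, hφ⟩ := D.exists_extension ((ker f).liftQ f le_rfl)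
    (ker_eq_bot.1 (Submodule.ker_liftQ_eq_bot _ _ _ le_rfl)) ((ker f).liftQ g h)
  have hφ' : ∀ x, φ (f x) = g x := fun x => hφ (Submodule.Quotient.mk x)
  have hker : ker φ ≤ D.R i := by
    refine (D.uniserial i).le_coatom (D.isCoatom i) fun ht => hR j ?_
    rw [← hg, range_eq_bot]
    ext x
    rw [← hφ', ker_eq_top.1 ht]
    rfl
  refine (D.isCoatom i).1 (eq_top_iff.2 fun x _ => ?_)
  obtain ⟨y, hy⟩ : φ x ∈ range g := hg ▸ D.range_le_of_ne hij φ ⟨x, rfl⟩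
  have h1 : x - f y ∈ D.R i := hker (by rw [mem_ker, map_sub, hφ', hy, sub_self])
  have h2 : f y ∈ D.R i := hf ▸ ⟨y, rfl⟩
  simpa using add_mem h1 h2

/-- The permutation of the indices induced by passing to the top of the radical. -/
theorem exists_perm [Finite ι] [Module.Injective Λ Λ] [IsNoetherianRing Λ]
    (hR : ∀ i, D.R i ≠ ⊥) :
    ∃ σ : Equiv.Perm ι, ∀ i, ∃ f : D.P (σ i) →ₗ[Λ] D.P i, range f = D.R i := by
  choose σ f hf using D.exists_cover_R hR
  have hinj : Function.Injective σ := by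
    intro i j hij
    obtain ⟨g, hg⟩ : ∃ g : D.P (σ i) →ₗ[Λ] D.P j, range g = D.R j := by
      rw [hij]
      exact ⟨f j, hf j⟩
    rcases D.uniserial (σ i) (ker (f i)) (ker g) with h | h
    · exact D.eq_of_ker_le hR _ _ (hf i) hg h
    · exact (D.eq_of_ker_le hR _ _ hg (hf i) h).symm
  exact ⟨Equiv.ofBijective σ (Finite.injective_iff_bijective.1 hinj), fun i => ⟨f i, hf i⟩⟩

theorem length_quotient_comap_add_one {i j : ι} (f : D.P j →ₗ[Λ] D.P i) (hf : range f = D.R i)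
    {A : Submodule Λ (D.P i)} (hA : A ≤ D.R i) :
    Module.length Λ (D.P i ⧸ A) = Module.length Λ (D.P j ⧸ A.comap f) + 1 := by
  have := isSimpleModule_iff_isCoatom.2 (D.isCoatom i)
  rw [← Module.length_eq_one (R := Λ) (M := D.P i ⧸ D.R i)]
  refine Module.length_eq_add_of_exact ((A.comap f).mapQ A f le_rfl) (Submodule.factor hA) ?_
    (Submodule.factor_surjective hA) ?_
  · rw [← ker_eq_bot, Submodule.ker_mapQ, ← Submodule.map_bot (A.comap f).mkQ, Submodule.map_bot]
    exact Submodule.mkQ_map_self _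
  · intro y
    obtain ⟨y, rfl⟩ := Submodule.Quotient.mk_surjective _ y
    rw [show Submodule.factor hA (Submodule.Quotient.mk y) = Submodule.Quotient.mk y from rfl,
      Submodule.Quotient.mk_eq_zero, ← hf]
    constructor
    · rintro ⟨x, rfl⟩
      exact ⟨Submodule.Quotient.mk x, rfl⟩
    · rintro ⟨x, hx⟩
      obtain ⟨x, rfl⟩ := Submodule.Quotient.mk_surjective _ x
      rw [Submodule.mapQ_apply, Submodule.Quotient.eq] at hx
      simpa using sub_mem (mem_range_self f x) (hf ▸ hA hx : f x - y ∈ range f)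

section Perm
variable {σ : Equiv.Perm ι}

theorem exists_range_eq
    (hσ : ∀ i, ∃ f : D.P (σ i) →ₗ[Λ] D.P i, range f = D.R i)
    (t : ℕ) (i : ι) {A : Submodule Λ (D.P i)} (hA : A ≠ ⊥)
    (ht : Module.length Λ (D.P i ⧸ A) = t) :
    ∃ F : D.P ((σ ^ t) i) →ₗ[Λ] D.P i, range F = A := by
  induction t generalizing i with
  | zero =>
    have := Module.length_eq_zero_iff.1 ht
    rw [pow_zero, Equiv.Perm.one_apply]
    exact ⟨LinearMap.id, by rw [range_id, Submodule.Quotient.subsingleton_iff.1 this]⟩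
  | succ t ih =>
    obtain ⟨f, hf⟩ := hσ i
    have hAR : A ≤ D.R i := by
      refine (D.uniserial i).le_coatom (D.isCoatom i) ?_
      rintro rfl
      rw [Module.length_eq_zero] at ht
      exact absurd ht.symm (by positivity)
    have hmap : (A.comap f).map f = A := Submodule.map_comap_eq_self (hf ▸ hAR)
    rw [D.length_quotient_comap_add_one f hf hAR] at ht
    push_cast at ht
    obtain ⟨F, hF⟩ := ih (σ i) (A := A.comap f)
      (fun h => hA (by rw [← hmap, h, Submodule.map_bot]))
      (by simpa using ht)
    rw [pow_succ, Equiv.Perm.mul_apply]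
    exact ⟨f ∘ₗ F, by rw [range_comp, hF, hmap]⟩

theorem length_quotient_le
    (hσ : ∀ i, ∃ f : D.P (σ i) →ₗ[Λ] D.P i, range f = D.R i)
    (t : ℕ) (i : ι) {A : Submodule Λ (D.P i)}
    (hA : radPow Λ t • (⊤ : Submodule Λ (D.P i)) ≤ A) : Module.length Λ (D.P i ⧸ A) ≤ t := by
  induction t generalizing i with
  | zero =>
    have : A = ⊤ := top_le_iff.1 ((Submodule.top_smul (⊤ : Submodule Λ (D.P i))).ge.trans hA)
    rw [this, Module.length_eq_zero]
    exact zero_le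
  | succ t ih =>
    by_cases hAt : A = ⊤
    · rw [hAt, Module.length_eq_zero]
      exact zero_le
    obtain ⟨f, hf⟩ := hσ i
    rw [D.length_quotient_comap_add_one f hf
      ((D.uniserial i).le_coatom (D.isCoatom i) hAt), Nat.cast_add, Nat.cast_one]
    gcongr
    refine ih (σ i) ?_
    rw [← Submodule.map_le_iff_le_comap, Submodule.map_smul'', Submodule.map_top, hf]
    refine le_trans ?_ hA
    rw [radPow_succ_smul]
    exact smul_mono_right _ ((D.uniserial i).coatom_le_smul_top (D.isCoatom i))

theorem length_le_of_radPow_eq_bot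
    (hσ : ∀ i, ∃ f : D.P (σ i) →ₗ[Λ] D.P i, range f = D.R i)
    {n : ℕ} (hn : radPow Λ n = ⊥) (i : ι) :
    Module.length Λ (D.P i) ≤ n := by
  rw [length_eq_add_quotient (⊥ : Submodule Λ (D.P i)), Module.length_bot, zero_add]
  refine D.length_quotient_le hσ n i ?_
  rw [hn, Submodule.bot_smul]

theorem length_le_length_apply
    (hσ : ∀ i, ∃ f : D.P (σ i) →ₗ[Λ] D.P i, range f = D.R i)
    [Module.Injective Λ Λ] (i : ι) :
    Module.length Λ (D.P i) ≤ Module.length Λ (D.P (σ i)) := by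
  obtain ⟨f, hf⟩ := hσ i
  have hker : ker f ≠ ⊥ := fun h => (D.isCoatom i).1
    (hf ▸ range_eq_top.2 (D.surjective_of_injective f (ker_eq_bot.1 h)))
  have := Submodule.nontrivial_iff_ne_bot.2 hker
  have h1 : (1 : ℕ∞) ≤ Module.length Λ (ker f) := Order.one_le_iff_pos.2 Module.length_pos
  have hk : ker f.rangeRestrict = ker f := ker_rangeRestrict f
  rw [length_eq_of_isCoatom (D.isCoatom i), length_eq_add_ker f.rangeRestrict
    f.surjective_rangeRestrict, hk, add_comm, hf]
  gcongr

variable [IsNoetherianRing Λ] [IsArtinianRing Λ]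

theorem exists_pow_eq
    (hσ : ∀ i, ∃ f : D.P (σ i) →ₗ[Λ] D.P i, range f = D.R i)
    {i j : ι} (g : D.P j →ₗ[Λ] D.P i) (hg : g ≠ 0) :
    ∃ t : ℕ, Module.length Λ (D.P i ⧸ range g) = t ∧ (σ ^ t) i = j := by
  obtain ⟨t, ht⟩ := ENat.ne_top_iff_exists.1
    (Module.length_ne_top (R := Λ) (M := D.P i ⧸ range g))
  have hne : range g ≠ ⊥ := fun h => hg (range_eq_bot.1 h)
  obtain ⟨F, hF⟩ := D.exists_range_eq hσ t i hne ht.symm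
  have := Submodule.nontrivial_iff_ne_bot.2 hne
  refine ⟨t, ht.symm, D.eq_of_surjective (M := range g)
    (F.codRestrict _ fun x => hF ▸ mem_range_self F x) g.rangeRestrict ?_
    g.surjective_rangeRestrict⟩
  rintro ⟨y, hy⟩
  obtain ⟨x, hx⟩ : y ∈ range F := hF ▸ hy
  exact ⟨x, Subtype.ext hx⟩

theorem sameCycle
    (hσ : ∀ i, ∃ f : D.P (σ i) →ₗ[Λ] D.P i, range f = D.R i)
    (hconn : ∀ e : Λ, IsIdempotentElem e → e ∈ Set.center Λ → e = 0 ∨ e = 1)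
    (a b : ι) : σ.SameCycle a b := by
  refine D.mem_of_connected hconn {j | σ.SameCycle a j} ?_ ?_ (Equiv.Perm.SameCycle.refl σ a) b
  · intro i hi j hj g
    by_contra hg
    obtain ⟨t, -, rfl⟩ := D.exists_pow_eq hσ g hg
    exact hj (Equiv.Perm.sameCycle_pow_right.1 hi)
  · intro i hi j hj g
    by_contra hg
    obtain ⟨t, -, rfl⟩ := D.exists_pow_eq hσ g hg
    exact hj (Equiv.Perm.sameCycle_pow_right.2 hi)

theorem length_le_length
    (hσ : ∀ i, ∃ f : D.P (σ i) →ₗ[Λ] D.P i, range f = D.R i)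
    [Finite ι] [Module.Injective Λ Λ]
    (hconn : ∀ e : Λ, IsIdempotentElem e → e ∈ Set.center Λ → e = 0 ∨ e = 1) (i j : ι) :
    Module.length Λ (D.P i) ≤ Module.length Λ (D.P j) := by
  obtain ⟨t, -, rfl⟩ := (D.sameCycle hσ hconn i j).exists_pow_eq'
  induction t with
  | zero => rfl
  | succ t ih =>
    rw [pow_succ', Equiv.Perm.mul_apply]
    exact ih.trans (D.length_le_length_apply hσ _)

end Perm

theorem exists_lt_length [IsNoetherianRing Λ] [IsArtinianRing Λ] {t : ℕ} (ht : radPow Λ t ≠ ⊥) :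
    ∃ i, (t : ℕ∞) < Module.length Λ (D.P i) := by
  by_contra! h
  have htop : (⨆ x : (i : ι) × (D.P i →ₗ[Λ] Λ), range x.2) = ⊤ := by
    by_contra hA
    obtain ⟨i, f, hf⟩ := D.exists_not_range_le hA
    exact hf (le_iSup (fun x : (i : ι) × (D.P i →ₗ[Λ] Λ) => range x.2) ⟨i, f⟩)
  refine ht (eq_bot_iff.2 fun x hx => ?_)
  have key : ∀ y ∈ ⨆ x : (i : ι) × (D.P i →ₗ[Λ] Λ), range x.2, x * y = 0 := by
    intro y hy
    induction hy using Submodule.iSup_induction' with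
    | zero => simp
    | add y z _ _ hy hz => rw [mul_add, hy, hz, add_zero]
    | mem f y hy =>
      obtain ⟨p, rfl⟩ := hy
      have hxp : x • p ∈ radPow Λ t • (⊤ : Submodule Λ (D.P f.1)) :=
        Submodule.smul_mem_smul hx trivial
      rw [radPow_smul_eq_bot t (h f.1), Submodule.mem_bot] at hxp
      rw [← smul_eq_mul, ← map_smul, hxp, map_zero]
  simpa using key 1 (htop ▸ Submodule.mem_top)

theorem exists_resolution {n : ℕ} (hn : 1 < n) (D : PimSystem Λ (Fin n)) [Module.Injective Λ Λ]
    [IsNoetherianRing Λ] [IsArtinianRing Λ]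
    (hconn : ∀ e : Λ, IsIdempotentElem e → e ∈ Set.center Λ → e = 0 ∨ e = 1)
    (htop : radPow Λ n = ⊥) (hbot : radPow Λ (n - 1) ≠ ⊥)
    {X : Type u} [AddCommGroup X] [Module Λ X] [Module.Finite Λ X] [Nontrivial X]
    (hX : Uniserial Λ X) (hXp : ¬ Module.Projective Λ X) :
    ∃ (i j : Fin n) (p : D.P i →ₗ[Λ] X) (q : D.P j →ₗ[Λ] ker p), Function.Surjective p ∧
      Function.Surjective q ∧ Nonempty (ker q ≃ₗ[Λ] X) ∧ ∀ g : ker p →ₗ[Λ] X, g = 0 := by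
  have : Nontrivial (Fin n) := Fin.nontrivial_iff_two_le.2 hn
  obtain ⟨σ, hσ⟩ := D.exists_perm (D.R_ne_bot hconn)
  have hlen : ∀ i, Module.length Λ (D.P i) = n := by
    intro i
    refine le_antisymm (D.length_le_of_radPow_eq_bot hσ htop i) ?_
    obtain ⟨j, hj⟩ := D.exists_lt_length hbot
    have := (Order.add_one_le_of_lt hj).trans (D.length_le_length hσ hconn j i)
    rwa [← ENat.natCast_one, ← ENat.natCast_add, Nat.sub_add_cancel hn.le] at this
  have hcycle : σ.IsCycleOn (Finset.univ : Finset (Fin n)) :=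
    ⟨by simp, fun a _ b _ => D.sameCycle hσ hconn a b⟩
  have hpow : ∀ (a : Fin n) (s t : ℕ), (σ ^ s) a = (σ ^ t) a ↔ s ≡ t [MOD n] := by
    intro a s t
    simpa using hcycle.pow_apply_eq_pow_apply (Finset.mem_univ a) (m := s) (n := t)
  obtain ⟨a, p, hp⟩ := D.exists_surjective hX
  obtain ⟨t, ht⟩ := ENat.ne_top_iff_exists.1 (Module.length_ne_top (R := Λ) (M := X))
  obtain ⟨s, hs⟩ := ENat.ne_top_iff_exists.1 (Module.length_ne_top (R := Λ) (M := ker p))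
  have hst : n = s + t := by
    have := length_eq_add_ker p hp
    rw [hlen, ← hs, ← ht] at this
    exact_mod_cast this
  have hK : ker p ≠ ⊥ := fun h => hXp
    (Module.Projective.of_equiv (LinearEquiv.ofBijective p ⟨ker_eq_bot.1 h, hp⟩))
  have ht0 : 0 < t := by
    have := Module.length_pos (R := Λ) (M := X)
    rw [← ht] at this
    exact_mod_cast this
  have hs0 : 0 < s := by
    have := Submodule.nontrivial_iff_ne_bot.2 hK
    have := Module.length_pos (R := Λ) (M := ker p)
    rw [← hs] at this
    exact_mod_cast this
  have hquot : Module.length Λ (D.P a ⧸ ker p) = t := by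
    rw [ht, (quotKerEquivOfSurjective p hp).length_eq]
  obtain ⟨F, hF⟩ := D.exists_range_eq hσ t a hK hquot
  let q : D.P ((σ ^ t) a) →ₗ[Λ] ker p := F.codRestrict _ fun x => hF ▸ mem_range_self F x
  have hq : Function.Surjective q := by
    rintro ⟨y, hy⟩
    obtain ⟨x, hx⟩ : y ∈ range F := hF ▸ hy
    exact ⟨x, Subtype.ext hx⟩
  refine ⟨a, (σ ^ t) a, p, q, hp, hq, ?_, fun g => ?_⟩
  · have hkq : Module.length Λ (ker q) = t := by
      obtain ⟨m, hm⟩ := ENat.ne_top_iff_exists.1 (Module.length_ne_top (R := Λ) (M := ker q))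
      have := length_eq_add_ker q hq
      rw [hlen, ← hs, ← hm] at this
      have : n = m + s := by exact_mod_cast this
      rw [← hm, show m = t by omega]
    have hkb : ker q ≠ ⊥ := by
      intro h
      rw [h, Module.length_bot] at hkq
      exact ht0.ne (by exact_mod_cast hkq)
    have hqs : Module.length Λ (D.P ((σ ^ t) a) ⧸ ker q) = s := by
      rw [hs, (quotKerEquivOfSurjective q hq).length_eq]
    obtain ⟨G, hG⟩ := D.exists_range_eq hσ s _ hkb hqs
    have hc : (σ ^ s) ((σ ^ t) a) = a := by
      rw [← Equiv.Perm.mul_apply, ← pow_add, ← hst]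
      exact (hpow a n 0).2 (by simp [Nat.ModEq])
    obtain ⟨G, hG⟩ : ∃ G : D.P a →ₗ[Λ] D.P ((σ ^ t) a), range G = ker q := by
      rw [← hG]
      clear * - hc
      revert G
      rw [hc]
      exact fun G => ⟨G, rfl⟩
    have hkG : ker G = ker p := by
      refine (D.uniserial a).eq_of_length_eq ?_
      obtain ⟨m, hm⟩ := ENat.ne_top_iff_exists.1 (Module.length_ne_top (R := Λ) (M := ker G))
      have := length_eq_add_ker G.rangeRestrict G.surjective_rangeRestrict
      rw [ker_rangeRestrict, hlen, hG, hkq, ← hm] at this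
      have : n = m + t := by exact_mod_cast this
      rw [← hs, ← hm, show m = s by omega]
    exact ⟨(LinearEquiv.ofEq _ _ hG.symm).trans (G.quotKerEquivRange.symm.trans
      ((Submodule.quotEquivOfEq _ _ hkG).trans (quotKerEquivOfSurjective p hp)))⟩
  · by_contra hg
    obtain ⟨h, hh⟩ := Module.projective_lifting_property p (g ∘ₗ q) hp
    have hnle : ¬ range h ≤ ker p := by
      intro hle
      refine hg (LinearMap.ext fun y => ?_)
      obtain ⟨x, rfl⟩ := hq y
      exact (LinearMap.congr_fun hh x).symm.trans (hle ⟨x, rfl⟩)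
    have hlt : ker p < range h := lt_of_le_not_ge (((D.uniserial a) _ _).resolve_right hnle) hnle
    obtain ⟨r, hr, hra⟩ := D.exists_pow_eq hσ h fun h0 =>
      hnle (by rw [h0, range_zero]; exact bot_le)
    have hrt : r < t := by
      have := Order.coheight_strictAnti hlt (by
        rw [← Module.length_quotient]
        exact Module.length_ne_top.lt_top)
      rw [← Module.length_quotient, ← Module.length_quotient, hr, hquot] at this
      exact_mod_cast this
    have := ((hpow a r t).1 hra).eq_of_lt_of_lt (by omega) (by omega)
    omega

end PimSystem

section Cover

open Module

theorem exists_indec_projective_cover [IsNoetherianRing Λ] [IsArtinianRing Λ] {T : Type u}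
    [AddCommGroup T] [Module Λ T] (P : ModuleCat.{u} Λ) [Module.Projective Λ P]
    [Module.Finite Λ P] (π : P →ₗ[Λ] T) (hπ : π ≠ 0) :
    ∃ (Q : ModuleCat.{u} Λ) (ρ : Q →ₗ[Λ] T), Module.Projective Λ Q ∧ Module.Finite Λ Q ∧
      Indec Λ Q ∧ ρ ≠ 0 := by
  induction hm : Module.length Λ P using WellFoundedLT.induction generalizing P with
  | ind m ih =>
  by_cases hP : Indec Λ P
  · exact ⟨P, π, ‹_›, ‹_›, hP, hπ⟩
  have hP0 : ¬ IsZero P := fun h ↦ hπ <| by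
    have := ModuleCat.subsingleton_of_isZero h
    exact Subsingleton.elim _ _
  simp only [Indec, hP0, not_false_eq_true, true_and, not_forall, not_or] at hP
  obtain ⟨A, B, ⟨e⟩, hA, hB⟩ := hP
  let ε : P ≃ₗ[Λ] A × B := (e ≪≫ ModuleCat.biprodIsoProd A B).toLinearEquiv
  have hlen : m = length Λ A + length Λ B := by
    rw [← hm, ε.length_eq, length_prod]
  have : Module.Projective Λ (A × B) := .of_equiv ε
  have : Module.Finite Λ (A × B) := .equiv ε
  have : Module.Projective Λ A := .of_split (.inl Λ A B) (.fst Λ A B) (by ext; rfl)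
  have : Module.Projective Λ B := .of_split (.inr Λ A B) (.snd Λ A B) (by ext; rfl)
  have : Module.Finite Λ A := .of_surjective (.fst Λ A B) LinearMap.fst_surjective
  have : Module.Finite Λ B := .of_surjective (.snd Λ A B) LinearMap.snd_surjective
  have hA' : length Λ A ≠ 0 := fun h ↦ hA <| by
    have := length_eq_zero_iff.1 h
    exact ModuleCat.isZero_of_subsingleton A
  have hB' : length Λ B ≠ 0 := fun h ↦ hB <| by
    have := length_eq_zero_iff.1 h
    exact ModuleCat.isZero_of_subsingleton B
  have hAt : length Λ A ≠ ⊤ := length_ne_top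
  have hBt : length Λ B ≠ ⊤ := length_ne_top
  by_cases hπA : π ∘ₗ ε.symm.toLinearMap ∘ₗ .inl Λ A B = 0
  · refine ih _ ?_ B (π ∘ₗ ε.symm.toLinearMap ∘ₗ .inr Λ A B) (fun hπB ↦ hπ ?_) rfl
    · rw [hlen, add_comm]
      exact lt_of_le_of_ne le_self_add fun h ↦
        hA' (WithTop.add_left_cancel hBt ((add_zero _).trans h)).symm
    · have : π ∘ₗ ε.symm.toLinearMap = 0 := LinearMap.prod_ext hπA hπB
      ext x
      simpa using LinearMap.congr_fun this (ε x)
  · refine ih _ ?_ A _ hπA rfl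
    rw [hlen]
    exact lt_of_le_of_ne le_self_add fun h ↦
      hB' (WithTop.add_left_cancel hAt ((add_zero _).trans h)).symm

/-- The indecomposable projective modules of a self-injective Nakayama algebra. -/
theorem IsSelfInjNakayama.nonempty_pimSystem {k : Type u} [Field k] [Algebra k Λ] {n m : ℕ}
    [IsNoetherianRing Λ] [IsArtinianRing Λ] (hΛ : IsSelfInjNakayama k Λ n m) :
    Nonempty (PimSystem Λ (Fin n)) := by
  obtain ⟨S, hS, hinj, hsurj⟩ := hΛ.simples
  have key (i : Fin n) : ∃ (Q : ModuleCat.{u} Λ) (ρ : Q →ₗ[Λ] S i), Module.Projective Λ Q ∧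
      Module.Finite Λ Q ∧ Indec Λ Q ∧ Function.Surjective ρ := by
    have := hS i
    have := IsSimpleModule.nontrivial Λ (S i)
    obtain ⟨x, hx⟩ := exists_ne (0 : S i)
    obtain ⟨Q, ρ, h₁, h₂, h₃, h₄⟩ := exists_indec_projective_cover (ModuleCat.of Λ Λ)
      (LinearMap.toSpanSingleton Λ (S i) x) (fun h ↦ hx (by
        simpa using LinearMap.congr_fun h (1 : Λ)))
    exact ⟨Q, ρ, h₁, h₂, h₃, LinearMap.surjective_of_ne_zero h₄⟩
  choose P π hproj hfin hind hπ using key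
  let e (i : Fin n) : (P i ⧸ LinearMap.ker (π i)) ≃ₗ[Λ] S i :=
    (π i).quotKerEquivOfSurjective (hπ i)
  exact ⟨{
    P := P
    R := fun i ↦ LinearMap.ker (π i)
    projective := hproj
    finite := hfin
    uniserial := fun i ↦ hΛ.uniserial _ (hfin i) (hind i)
    isCoatom := fun i ↦ by
      have := hS i
      exact isSimpleModule_iff_isCoatom.1 (IsSimpleModule.congr (e i))
    eq_of_equiv := fun i j ⟨f⟩ ↦ hinj i j ⟨((e i).symm ≪≫ₗ f ≪≫ₗ e j).toModuleIso⟩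
    exists_equiv := fun T _ _ hT ↦ by
      obtain ⟨i, ⟨f⟩⟩ := hsurj (ModuleCat.of Λ T) hT
      exact ⟨i, ⟨f.toLinearEquiv ≪≫ₗ (e i).symm⟩⟩ }⟩

end Cover

end Nakayama

/-- for `Λ = A_{n,n}` with `n > 1`, every non-projective indecomposable
module `X` satisfies `Ext¹(X,X) = 0` and `Ext²(X,X) ≠ 0`; that is, `rd(X) = 1`. -/
theorem statement8 (k : Type u) [Field k] (Λ : Type u) [Ring Λ] [Algebra k Λ]
    (n : ℕ) (hn : 1 < n)
    (hΛ : IsSelfInjNakayama k Λ n n)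
    [HasExt.{u} (ModuleCat.{u} Λ)]
    (X : ModuleCat.{u} Λ) (hXfin : Module.Finite Λ X) (hXind : Indec Λ X)
    (hXnp : ¬ Projective X) :
    Subsingleton (Abelian.Ext X X 1) ∧ (¬ Subsingleton (Abelian.Ext X X 2)) ∧
    rigDeg Λ X = 1 := by
  have := hΛ.findim
  have : IsNoetherianRing Λ := IsNoetherianRing.of_finite k Λ
  have : IsArtinianRing Λ := IsArtinianRing.of_finite k Λ
  have : Module.Injective Λ Λ :=
    Module.injective_module_of_injective_object Λ Λ (inj := hΛ.selfinj)
  obtain ⟨D⟩ := hΛ.nonempty_pimSystem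
  have : Nontrivial X := by
    by_contra h
    have := not_nontrivial_iff_subsingleton.1 h
    exact hXind.1 (ModuleCat.isZero_of_subsingleton X)
  have hXp : ¬ Module.Projective Λ X := fun h ↦
    hXnp ((IsProjective.iff_projective (R := Λ) X).1 h)
  obtain ⟨i, j, p, q, hp, hq, ⟨e⟩, h⟩ := D.exists_resolution hn hΛ.connected hΛ.loewy_top
    hΛ.loewy_bot (hΛ.uniserial X hXfin hXind) hXp
  have h₁ : Subsingleton (Abelian.Ext X X 1) := subsingleton_ext_one p hp h
  have h₂ : ¬ Subsingleton (Abelian.Ext X X 2) := not_subsingleton_ext_two p hp q hq e hXp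
  exact ⟨h₁, h₂, rigDeg_eq_one X h₁ h₂⟩

end Rigidity
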